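/- For every τ ∈ ℝ and ν ∈ ℝ, the ambiguity function of the OFDM sequence satisfies Λ̃(τ,ν) = Σ_{n1=0}^{N−1} Σ_{n2=0}^{N−1} Σ_{l1=0}^{L−1} Σ_{l2=0}^{L−1} X_{n1,l1}·conj(X_{n2,l2})·K(n1,n2,l1,l2;τ,ν), where K(n1,n2,l1,l2;τ,ν) = T̃_diff·sinc(((l1−l2)·Δf − ν)·T̃_diff)·exp(i·2π·(((l1−l2)·Δf − ν)·T̃_avg + l2·Δf·((n2−n1)·T_p + τ) − n1·ν·T_p)), with T̃_min = max(0, τ + (n2−n1)·T_p), T̃_max = min(T_p, T_p + τ + (n2−n1)·T_p), T̃_diff = max(0, T̃_max − T̃_min), and T̃_avg = (T̃_max + T̃_min)/2 (so that terms whose supports do not overlap vanish). -/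

import Mathlib

open MeasureTheory

/-- `sinc x = sin(πx)/(πx)` for `x ≠ 0`, and `sinc 0 = 1`. -/
noncomputable def sinc (x : ℝ) : ℝ :=
  if x = 0 then 1 else Real.sin (Real.pi * x) / (Real.pi * x)

/-- `T̃_min = max(0, τ + d T_p)` where `d = n2 − n1`. -/
noncomputable def seqTmin (Tp τ d : ℝ) : ℝ := max 0 (τ + d * Tp)

/-- `T̃_max = min(T_p, T_p + τ + d T_p)` where `d = n2 − n1`. -/
noncomputable def seqTmax (Tp τ d : ℝ) : ℝ := min Tp (Tp + τ + d * Tp)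

/-- `T̃_diff = max(0, T̃_max − T̃_min)`. -/
noncomputable def seqTdiff (Tp τ d : ℝ) : ℝ := max 0 (seqTmax Tp τ d - seqTmin Tp τ d)

/-- `T̃_avg = (T̃_max + T̃_min)/2`. -/
noncomputable def seqTavg (Tp τ d : ℝ) : ℝ := (seqTmax Tp τ d + seqTmin Tp τ d) / 2

/-- The OFDM sequence `s̃(t) = Σ_n Σ_l X_{n,l} exp(i 2π l Δf (t − n T_p))` on
`[n T_p, (n+1) T_p)`, zero outside `[0, N T_p]`, with `Δf = 1/T_p`. -/
noncomputable def ofdmSeq (N L : ℕ) (Tp : ℝ) (X : Fin N → Fin L → ℂ) (t : ℝ) : ℂ :=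
  ∑ n : Fin N,
    if (n : ℝ) * Tp ≤ t ∧ t < ((n : ℝ) + 1) * Tp then
      ∑ l : Fin L, X n l *
        Complex.exp (Complex.I * (2 * Real.pi * (l : ℝ) * (1 / Tp) * (t - (n : ℝ) * Tp)))
    else 0

/-- The ambiguity function `Λ̃(τ,ν) = ∫ s̃(t) conj(s̃(t−τ)) exp(−i 2π ν t) dt`. -/
noncomputable def ambiguitySeq (N L : ℕ) (Tp : ℝ) (X : Fin N → Fin L → ℂ) (τ ν : ℝ) : ℂ :=
  ∫ t : ℝ, ofdmSeq N L Tp X t * (starRingEnd ℂ) (ofdmSeq N L Tp X (t - τ)) *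
    Complex.exp (-(Complex.I * (2 * Real.pi * ν * t)))

/-- The deterministic kernel `K(n1,n2,l1,l2; τ,ν)`. -/
noncomputable def seqKernel (Tp τ ν : ℝ) (n1 n2 l1 l2 : ℝ) : ℂ :=
  ((seqTdiff Tp τ (n2 - n1) *
      sinc (((l1 - l2) * (1 / Tp) - ν) * seqTdiff Tp τ (n2 - n1)) : ℝ) : ℂ) *
    Complex.exp (Complex.I * (2 * Real.pi *
      (((l1 - l2) * (1 / Tp) - ν) * seqTavg Tp τ (n2 - n1) +
        l2 * (1 / Tp) * ((n2 - n1) * Tp + τ) - n1 * ν * Tp)))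

/-- The exponential integral over an interval in terms of `sinc`, centred at the midpoint. -/
lemma intervalIntegral_exp_eq_sinc (f a b : ℝ) :
    ∫ u in a..b, Complex.exp (Complex.I * (2 * Real.pi * (f * u))) =
      (((b - a) * sinc (f * (b - a)) : ℝ) : ℂ) *
        Complex.exp (Complex.I * (2 * Real.pi * (f * ((b + a) / 2)))) := by
  have hpi : (Real.pi : ℂ) ≠ 0 := Complex.ofReal_ne_zero.2 Real.pi_ne_zero
  rcases eq_or_ne f 0 with rfl | hf
  · simp [sinc]
  rcases eq_or_ne (b - a) 0 with hab | hab
  · obtain rfl : b = a := by linarith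
    simp
  have hf' : (f : ℂ) ≠ 0 := Complex.ofReal_ne_zero.2 hf
  have hab' : (b : ℂ) - a ≠ 0 := by exact_mod_cast hab
  have hc : Complex.I * (2 * Real.pi * f) ≠ 0 := by simp [hf]
  have hint : ∀ u : ℝ, Complex.exp (Complex.I * (2 * Real.pi * (f * u))) =
      Complex.exp (Complex.I * (2 * Real.pi * f) * u) := fun u => by ring_nf
  simp_rw [hint]
  rw [integral_exp_mul_complex hc, sinc, if_neg (mul_ne_zero hf hab)]
  have hb : Complex.exp (Complex.I * (2 * Real.pi * f) * b) =
      Complex.exp (Real.pi * (f * (b - a)) * Complex.I) *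
        Complex.exp (Complex.I * (2 * Real.pi * (f * ((b + a) / 2)))) := by
    rw [← Complex.exp_add]; ring_nf
  have ha : Complex.exp (Complex.I * (2 * Real.pi * f) * a) =
      Complex.exp (-(Real.pi * (f * (b - a))) * Complex.I) *
        Complex.exp (Complex.I * (2 * Real.pi * (f * ((b + a) / 2)))) := by
    rw [← Complex.exp_add]; ring_nf
  rw [hb, ha]
  push_cast
  rw [Complex.sin]
  field_simp
  linear_combination (Complex.exp (Real.pi * f * (b - a) * Complex.I) -
    Complex.exp (-(Real.pi * f * (b - a) * Complex.I))) * Complex.I_sq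

/-- The `l`-th subcarrier of the `n`-th OFDM symbol. -/
noncomputable def ofdmPulse (Tp n l t : ℝ) : ℂ :=
  if n * Tp ≤ t ∧ t < (n + 1) * Tp then
    Complex.exp (Complex.I * (2 * Real.pi * l * (1 / Tp) * (t - n * Tp)))
  else 0

lemma ofdmSeq_eq_sum_pulse (N L : ℕ) (Tp : ℝ) (X : Fin N → Fin L → ℂ) (t : ℝ) :
    ofdmSeq N L Tp X t = ∑ n : Fin N, ∑ l : Fin L, X n l * ofdmPulse Tp n l t := by
  refine Finset.sum_congr rfl fun n _ => ?_
  unfold ofdmPulse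
  split_ifs <;> simp

/-- The product of two shifted pulses is a modulated exponential on the overlap of supports. -/
lemma ofdmPulse_mul_conj_eq_indicator (Tp τ ν n1 n2 l1 l2 t : ℝ) :
    ofdmPulse Tp n1 l1 t * (starRingEnd ℂ) (ofdmPulse Tp n2 l2 (t - τ)) *
        Complex.exp (-(Complex.I * (2 * Real.pi * ν * t))) =
      (Set.Ico (seqTmin Tp τ (n2 - n1)) (seqTmax Tp τ (n2 - n1))).indicator
        (fun u : ℝ => Complex.exp (Complex.I * (2 * Real.pi *
            (l2 * (1 / Tp) * ((n2 - n1) * Tp + τ) - n1 * ν * Tp))) *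
          Complex.exp (Complex.I * (2 * Real.pi * (((l1 - l2) * (1 / Tp) - ν : ℝ) * u))))
        (t - n1 * Tp) := by
  have hmem : t - n1 * Tp ∈ Set.Ico (seqTmin Tp τ (n2 - n1)) (seqTmax Tp τ (n2 - n1)) ↔
      (n1 * Tp ≤ t ∧ t < (n1 + 1) * Tp) ∧ (n2 * Tp ≤ t - τ ∧ t - τ < (n2 + 1) * Tp) := by
    simp only [seqTmin, seqTmax, Set.mem_Ico, max_le_iff, lt_min_iff]
    constructor
    · rintro ⟨⟨_, _⟩, _, _⟩
      refine ⟨⟨?_, ?_⟩, ?_, ?_⟩ <;> linarith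
    · rintro ⟨⟨_, _⟩, _, _⟩
      refine ⟨⟨?_, ?_⟩, ?_, ?_⟩ <;> linarith
  unfold ofdmPulse
  by_cases h1 : n1 * Tp ≤ t ∧ t < (n1 + 1) * Tp
  · by_cases h2 : n2 * Tp ≤ t - τ ∧ t - τ < (n2 + 1) * Tp
    · rw [Set.indicator_of_mem (hmem.2 ⟨h1, h2⟩), if_pos h1, if_pos h2, ← Complex.exp_conj,
        ← Complex.exp_add, ← Complex.exp_add, ← Complex.exp_add]
      congr 1
      simp only [map_mul, map_sub, map_div₀, map_one, Complex.conj_I, Complex.conj_ofReal,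
        Complex.conj_ofNat]
      push_cast
      ring
    · rw [Set.indicator_of_notMem fun h => h2 (hmem.1 h).2, if_neg h2]
      simp
  · rw [Set.indicator_of_notMem fun h => h1 (hmem.1 h).1, if_neg h1]
    simp

lemma integrable_ofdmPulse_mul_conj (Tp τ ν n1 n2 l1 l2 : ℝ) :
    Integrable fun t : ℝ => ofdmPulse Tp n1 l1 t *
      (starRingEnd ℂ) (ofdmPulse Tp n2 l2 (t - τ)) *
        Complex.exp (-(Complex.I * (2 * Real.pi * ν * t))) := by
  simp_rw [ofdmPulse_mul_conj_eq_indicator]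
  refine Integrable.comp_sub_right (f := Set.indicator _ _) ?_ (n1 * Tp)
  rw [integrable_indicator_iff measurableSet_Ico]
  refine (Continuous.integrableOn_Icc ?_).mono_set Set.Ico_subset_Icc_self
  fun_prop

lemma integral_ofdmPulse_mul_conj (Tp τ ν n1 n2 l1 l2 : ℝ) :
    ∫ t : ℝ, ofdmPulse Tp n1 l1 t * (starRingEnd ℂ) (ofdmPulse Tp n2 l2 (t - τ)) *
        Complex.exp (-(Complex.I * (2 * Real.pi * ν * t))) =
      seqKernel Tp τ ν n1 n2 l1 l2 := by
  simp_rw [ofdmPulse_mul_conj_eq_indicator]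
  rw [integral_sub_right_eq_self (μ := volume) (Set.indicator _ _) (n1 * Tp),
    integral_indicator measurableSet_Ico, seqKernel]
  rcases le_total (seqTmin Tp τ (n2 - n1)) (seqTmax Tp τ (n2 - n1)) with h | h
  · rw [integral_Ico_eq_integral_Ioc, ← intervalIntegral.integral_of_le h,
      intervalIntegral.integral_const_mul, intervalIntegral_exp_eq_sinc, seqTdiff,
      max_eq_right (sub_nonneg.2 h), mul_left_comm, ← Complex.exp_add, seqTavg]
    congr 2
    push_cast
    ring
  · simp [Set.Ico_eq_empty_of_le h, seqTdiff, max_eq_left (sub_nonpos.2 h)]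

/-- For every `τ, ν ∈ ℝ`, the ambiguity function of the OFDM sequence is the quadruple sum
`Λ̃(τ,ν) = Σ_{n1,n2,l1,l2} X_{n1,l1} conj(X_{n2,l2}) K(n1,n2,l1,l2; τ,ν)`. -/
theorem ofdm_sequence_ambiguity_expansion
    (N L : ℕ) (hN : 1 ≤ N) (hL : 1 ≤ L) (Tp : ℝ) (hTp : 0 < Tp)
    (X : Fin N → Fin L → ℂ) (τ ν : ℝ) :
    ambiguitySeq N L Tp X τ ν =
      ∑ n1 : Fin N, ∑ n2 : Fin N, ∑ l1 : Fin L, ∑ l2 : Fin L,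
        X n1 l1 * (starRingEnd ℂ) (X n2 l2) *
          seqKernel Tp τ ν (n1 : ℝ) (n2 : ℝ) (l1 : ℝ) (l2 : ℝ) := by
  have hexpand : ∀ t : ℝ, ofdmSeq N L Tp X t * (starRingEnd ℂ) (ofdmSeq N L Tp X (t - τ)) *
      Complex.exp (-(Complex.I * (2 * Real.pi * ν * t))) =
      ∑ n1 : Fin N, ∑ n2 : Fin N, ∑ l1 : Fin L, ∑ l2 : Fin L,
        X n1 l1 * (starRingEnd ℂ) (X n2 l2) *
          (ofdmPulse Tp n1 l1 t * (starRingEnd ℂ) (ofdmPulse Tp n2 l2 (t - τ)) *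
            Complex.exp (-(Complex.I * (2 * Real.pi * ν * t)))) := by
    intro t
    simp only [ofdmSeq_eq_sum_pulse, map_sum, map_mul, Finset.sum_mul_sum]
    simp only [Finset.sum_mul]
    refine Finset.sum_congr rfl fun n1 _ => Finset.sum_congr rfl fun n2 _ =>
      Finset.sum_congr rfl fun l1 _ => Finset.sum_congr rfl fun l2 _ => ?_
    ring
  have hint : ∀ (n1 n2 : Fin N) (l1 l2 : Fin L), Integrable fun t : ℝ =>
      X n1 l1 * (starRingEnd ℂ) (X n2 l2) *
        (ofdmPulse Tp n1 l1 t * (starRingEnd ℂ) (ofdmPulse Tp n2 l2 (t - τ)) *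
          Complex.exp (-(Complex.I * (2 * Real.pi * ν * t)))) :=
    fun n1 n2 l1 l2 => (integrable_ofdmPulse_mul_conj Tp τ ν n1 n2 l1 l2).const_mul _
  simp_rw [ambiguitySeq, hexpand]
  rw [integral_finsetSum _ fun n1 _ => integrable_finsetSum _ fun n2 _ =>
    integrable_finsetSum _ fun l1 _ => integrable_finsetSum _ fun l2 _ => hint n1 n2 l1 l2]
  refine Finset.sum_congr rfl fun n1 _ => ?_
  rw [integral_finsetSum _ fun n2 _ => integrable_finsetSum _ fun l1 _ =>
    integrable_finsetSum _ fun l2 _ => hint n1 n2 l1 l2]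
  refine Finset.sum_congr rfl fun n2 _ => ?_
  rw [integral_finsetSum _ fun l1 _ => integrable_finsetSum _ fun l2 _ => hint n1 n2 l1 l2]
  refine Finset.sum_congr rfl fun l1 _ => ?_
  rw [integral_finsetSum _ fun l2 _ => hint n1 n2 l1 l2]
  refine Finset.sum_congr rfl fun l2 _ => ?_
  rw [integral_const_mul, integral_ofdmPulse_mul_conj]
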